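/- arXiv:2109.13750 — 3 statements merged into one kernel-verified Lean document; each statement's English description precedes it below -/
import Mathlib

section
/- Every countably generated Mittag-Leffler module is pure-projective. -/
/-!
STATEMENT 1: Every countably generated Mittag-Leffler module is pure-projective.
-/

open TensorProduct

universe u v

/-- The canonical map `M ⊗ (∏ i, L i) → ∏ i (M ⊗ L i)`. -/
noncomputable def canonicalTensorPi (R : Type u) [CommRing R]
    (M : Type v) [AddCommGroup M] [Module R M]
    (ι : Type v) (L : ι → Type v) [∀ i, AddCommGroup (L i)] [∀ i, Module R (L i)] :
    TensorProduct R M (∀ i, L i) →ₗ[R] ∀ i, TensorProduct R M (L i) :=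
  LinearMap.pi fun i => LinearMap.lTensor M (LinearMap.proj i)

/-- `M` is Mittag-Leffler: for every family of modules `L i`, the canonical map
`M ⊗ ∏ L i → ∏ (M ⊗ L i)` is injective. -/
def IsMittagLeffler (R : Type u) [CommRing R]
    (M : Type v) [AddCommGroup M] [Module R M] : Prop :=
  ∀ (ι : Type v) (L : ι → Type v) [∀ i, AddCommGroup (L i)] [∀ i, Module R (L i)],
    Function.Injective (canonicalTensorPi R M ι L)

/-- A submodule `N ≤ M` is pure if `N ⊗ L → M ⊗ L` is injective for every module `L`. -/
def IsPureSubmodule (R : Type u) [CommRing R]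
    (M : Type v) [AddCommGroup M] [Module R M] (N : Submodule R M) : Prop :=
  ∀ (L : Type v) [AddCommGroup L] [Module R L],
    Function.Injective (LinearMap.rTensor L N.subtype)

/-- A surjection is a pure epimorphism if its kernel is a pure submodule of the domain. -/
def IsPureEpi (R : Type u) [CommRing R]
    {N : Type v} [AddCommGroup N] [Module R N] {M : Type v} [AddCommGroup M] [Module R M]
    (f : N →ₗ[R] M) : Prop :=
  Function.Surjective f ∧ IsPureSubmodule R N (LinearMap.ker f)

/-- `M` is pure-projective: every pure epimorphism onto `M` splits. -/
def IsPureProjective (R : Type u) [CommRing R]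
    (M : Type v) [AddCommGroup M] [Module R M] : Prop :=
  ∀ (N : Type v) [AddCommGroup N] [Module R N] (f : N →ₗ[R] M),
    IsPureEpi R f → ∃ g : M →ₗ[R] N, f.comp g = LinearMap.id

/-- A primitive positive formula in variables indexed by naturals. -/
structure PPF (R : Type u) where
  eq : Type
  va : Type
  fe : Fintype eq
  fv : Fintype va
  a : eq → ℕ → R
  b : eq → va → R

attribute [instance] PPF.fe PPF.fv

/-- Satisfaction of a formula, using only the first `k` variables. -/
def PPF.Sat {R : Type u} [CommRing R] (φ : PPF R) (k : ℕ) {X : Type v} [AddCommGroup X]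
    [Module R X] (x : ℕ → X) : Prop :=
  ∃ y : φ.va → X, ∀ i, ∑ j ∈ Finset.range k, φ.a i j • x j + ∑ j, φ.b i j • y j = 0

lemma PPF.Sat.sub {R : Type u} [CommRing R] {φ : PPF R} {k : ℕ} {X : Type v} [AddCommGroup X]
    [Module R X] {x x' : ℕ → X} (h : φ.Sat k x) (h' : φ.Sat k x') :
    φ.Sat k (fun i => x i - x' i) := by
  obtain ⟨y, hy⟩ := h
  obtain ⟨y', hy'⟩ := h'
  refine ⟨fun i => y i - y' i, fun i => ?_⟩
  have := congrArg₂ (· - ·) (hy i) (hy' i)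
  simp only [smul_sub, Finset.sum_sub_distrib] at this ⊢
  rw [sub_zero] at this
  rw [← this]; abel

lemma PPF.Sat.map {R : Type u} [CommRing R] {φ : PPF R} {k : ℕ} {X : Type v} [AddCommGroup X]
    [Module R X] {Y : Type v} [AddCommGroup Y] [Module R Y] {x : ℕ → X} (h : φ.Sat k x)
    (f : X →ₗ[R] Y) : φ.Sat k (fun i => f (x i)) := by
  obtain ⟨y, hy⟩ := h
  refine ⟨fun i => f (y i), fun i => ?_⟩
  have := congrArg f (hy i)
  simpa using this

lemma PPF.Sat.congr {R : Type u} [CommRing R] {φ : PPF R} {k : ℕ} {X : Type v} [AddCommGroup X]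
    [Module R X] {x x' : ℕ → X} (h : φ.Sat k x) (hx : ∀ i < k, x i = x' i) : φ.Sat k x' := by
  obtain ⟨y, hy⟩ := h
  refine ⟨y, fun i => ?_⟩
  rw [← hy i]
  congr 1
  refine Finset.sum_congr rfl fun j hj => ?_
  rw [hx j (Finset.mem_range.1 hj)]

/-- view a formula in the first `k` variables as one in which variable `k` is unused -/
def PPF.weaken {R : Type u} [CommRing R] (φ : PPF R) (k : ℕ) : PPF R where
  eq := φ.eq
  va := φ.va
  fe := φ.fe
  fv := φ.fv
  a := fun i j => if j < k then φ.a i j else 0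
  b := φ.b

lemma PPF.sat_weaken {R : Type u} [CommRing R] (φ : PPF R) {k : ℕ} {X : Type v} [AddCommGroup X]
    [Module R X] (x : ℕ → X) : (φ.weaken k).Sat (k+1) x ↔ φ.Sat k x := by
  have : ∀ i, ∑ j ∈ Finset.range (k+1), (φ.weaken k).a i j • x j
      = ∑ j ∈ Finset.range k, φ.a i j • x j := by
    intro i
    rw [Finset.sum_range_succ]
    simp only [PPF.weaken, lt_irrefl, if_false, zero_smul, add_zero]
    refine Finset.sum_congr rfl fun j hj => ?_
    rw [if_pos (Finset.mem_range.1 hj)]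
  unfold PPF.Sat
  simp only [this]
  rfl

/-- quantify out the variable `k` -/
def PPF.ex {R : Type u} [CommRing R] (φ : PPF R) (k : ℕ) : PPF R where
  eq := φ.eq
  va := Option φ.va
  fe := φ.fe
  fv := inferInstance
  a := φ.a
  b := fun i j => j.elim (φ.a i k) (φ.b i)

lemma PPF.sat_ex {R : Type u} [CommRing R] (φ : PPF R) {k : ℕ} {X : Type v} [AddCommGroup X]
    [Module R X] (x : ℕ → X) :
    (φ.ex k).Sat k x ↔ ∃ e : X, φ.Sat (k+1) (Function.update x k e) := by
  have key : ∀ (e : X) (i : φ.eq), ∑ j ∈ Finset.range (k+1), φ.a i j • Function.update x k e j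
      = ∑ j ∈ Finset.range k, φ.a i j • x j + φ.a i k • e := by
    intro e i
    rw [Finset.sum_range_succ, Function.update_self]
    congr 1
    refine Finset.sum_congr rfl fun j hj => ?_
    rw [Function.update_of_ne (Finset.mem_range.1 hj).ne]
  unfold PPF.Sat
  simp only [key]
  constructor
  · rintro ⟨y, hy⟩
    refine ⟨y none, fun j => y (some j), fun i => ?_⟩
    rw [← hy i]
    erw [Fintype.sum_option]
    simp [PPF.ex, add_assoc]
  · rintro ⟨e, y, hy⟩
    refine ⟨fun j => Option.elim j e y, fun i => ?_⟩
    rw [← hy i]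
    erw [Fintype.sum_option]
    simp [PPF.ex, add_assoc]

/-- test modules -/
lemma exists_test_module (R : Type u) [CommRing R] (X : Type v) [AddCommGroup X] [Module R X]
    {ε μ : Type} [Fintype ε] [Fintype μ] (b : ε → μ → R) :
    ∃ (L : Type v) (_ : AddCommGroup L) (_ : Module R L) (e : ε → L),
      (∀ j, ∑ i, b i j • e i = 0) ∧
      ∀ c : ε → X, ∑ i, c i ⊗ₜ[R] e i = 0 → ∃ y : μ → X, ∀ i, ∑ j, b i j • y j = c i := by
  classical
  let B : (μ → X) →ₗ[R] (ε → X) :=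
    LinearMap.pi fun i => ∑ j, b i j • LinearMap.proj j
  have hB : ∀ y i, B y i = ∑ j, b i j • y j := by
    intro y i; simp [B]
  let Q := (ε → X) ⧸ LinearMap.range B
  let e : ε → (X →ₗ[R] Q) := fun i => (LinearMap.range B).mkQ ∘ₗ LinearMap.single R (fun _ => X) i
  refine ⟨X →ₗ[R] Q, inferInstance, inferInstance, e, ?_, ?_⟩
  · intro j
    ext n
    have : (∑ i, b i j • e i) n = (LinearMap.range B).mkQ (B (Pi.single j n)) := by
      simp only [e, LinearMap.sum_apply, LinearMap.smul_apply, LinearMap.comp_apply]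
      simp only [← map_smul, ← map_sum]
      congr 1
      ext i
      rw [hB]
      simp [Finset.sum_apply, Pi.single_apply, LinearMap.single_apply]
    rw [this]
    exact (Submodule.Quotient.mk_eq_zero _).2 ⟨_, rfl⟩
  · intro c hc
    let ev : X ⊗[R] (X →ₗ[R] Q) →ₗ[R] Q :=
      TensorProduct.lift (LinearMap.flip LinearMap.id)
    have h := congrArg ev hc
    have h2 : ev (∑ i, c i ⊗ₜ[R] e i) = (LinearMap.range B).mkQ c := by
      simp only [map_sum, ev, TensorProduct.lift.tmul, LinearMap.flip_apply, LinearMap.id_apply, e,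
        LinearMap.comp_apply]
      rw [← map_sum]
      congr 1
      exact LinearMap.sum_single_apply _ c
    rw [h2, map_zero] at h
    rw [Submodule.mkQ_apply, Submodule.Quotient.mk_eq_zero] at h
    obtain ⟨y, hy⟩ := h
    exact ⟨y, fun i => by rw [← hB, hy]⟩

lemma pure_solve {R : Type u} [CommRing R] {N : Type v} [AddCommGroup N] [Module R N]
    {K : Submodule R N} (hK : IsPureSubmodule R N K)
    {ε μ : Type} [Fintype ε] [Fintype μ] (b : ε → μ → R) (c : ε → K) (y : μ → N)
    (h : ∀ i, ∑ j, b i j • y j = (c i : N)) :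
    ∃ y' : μ → K, ∀ i, ∑ j, b i j • y' j = c i := by
  obtain ⟨L, _, _, e, he, H⟩ := exists_test_module R K b
  apply H
  apply hK L
  simp only [map_sum, LinearMap.rTensor_tmul, Submodule.subtype_apply, map_zero, ← h]
  simp only [TensorProduct.sum_tmul, TensorProduct.smul_tmul]
  rw [Finset.sum_comm]
  simp only [← TensorProduct.tmul_sum, he, TensorProduct.tmul_zero, Finset.sum_const_zero]

lemma pure_sat {R : Type u} [CommRing R] {N : Type v} [AddCommGroup N] [Module R N]
    {K : Submodule R N} (hK : IsPureSubmodule R N K) (φ : PPF R) (k : ℕ) (d : ℕ → K)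
    (h : φ.Sat k (fun i => (d i : N))) : φ.Sat k d := by
  obtain ⟨y, hy⟩ := h
  obtain ⟨y', hy'⟩ := pure_solve hK φ.b (fun i => - ∑ j ∈ Finset.range k, φ.a i j • d j) y
    (fun i => by
      rw [eq_comm]
      have := hy i
      push_cast
      rw [neg_eq_iff_add_eq_zero, this])
  exact ⟨y', fun i => by rw [hy' i]; abel⟩

lemma pure_lift {R : Type u} [CommRing R] {N : Type v} [AddCommGroup N] [Module R N]
    {M : Type v} [AddCommGroup M] [Module R M] {f : N →ₗ[R] M} (hf : IsPureEpi R f)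
    (φ : PPF R) (k : ℕ) (x : ℕ → M) (h : φ.Sat k x) :
    ∃ z : ℕ → N, (∀ i, f (z i) = x i) ∧ φ.Sat k z := by
  obtain ⟨hs, hK⟩ := hf
  obtain ⟨y, hy⟩ := h
  choose g hg using hs
  let c : φ.eq → LinearMap.ker f := fun i =>
    ⟨∑ j ∈ Finset.range k, φ.a i j • g (x j) + ∑ j, φ.b i j • g (y j), by
      simp [LinearMap.mem_ker, hg, hy i]⟩
  obtain ⟨w, hw⟩ := pure_solve hK (μ := Fin k ⊕ φ.va)
    (fun i => Sum.elim (fun j => φ.a i j) (φ.b i)) c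
    (Sum.elim (fun j => g (x j)) (fun j => g (y j))) (fun i => by
      simp [c, Fintype.sum_sum_type, Finset.sum_range])
  refine ⟨fun j => g (x j) - (if h : j < k then (w (Sum.inl ⟨j, h⟩) : N) else 0), ?_,
    fun j => g (y j) - w (Sum.inr j), ?_⟩
  · intro i
    rw [map_sub, hg]
    split_ifs with h
    · simp
    · simp
  · intro i
    have := congrArg Subtype.val (hw i)
    simp only [Fintype.sum_sum_type, c, Sum.elim_inl, Sum.elim_inr, Submodule.coe_add,
      Submodule.coe_sum, Submodule.coe_smul, Finset.sum_range] at this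
    simp only [Finset.sum_range, smul_sub, Finset.sum_sub_distrib, Fin.is_lt, dite_true, Fin.eta]
    rw [sub_add_sub_comm, ← this, sub_self]

lemma tensor_zero_formula {R : Type u} [CommRing R] {M : Type v} [AddCommGroup M] [Module R M]
    {L : Type v} [AddCommGroup L] [Module R L] (k : ℕ) (x : ℕ → M) (l : ℕ → L)
    (h : ∑ j ∈ Finset.range k, x j ⊗ₜ[R] l j = 0) :
    ∃ φ : PPF R, φ.Sat k x ∧ ∀ (X : Type v) [AddCommGroup X] [Module R X] (z : ℕ → X),
      φ.Sat k z → ∑ j ∈ Finset.range k, z j ⊗ₜ[R] l j = 0 := by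
  let P : Submodule R M := Submodule.span R (Set.range fun j : Fin k => x j)
  have hP : P.FG := Submodule.fg_span (Set.finite_range _)
  have hxP : ∀ j : Fin k, x j ∈ P := fun j => Submodule.subset_span ⟨j, rfl⟩
  obtain ⟨Q, hPQ, hQ, h0⟩ := TensorProduct.eq_zero_of_fg_of_subtype_eq_zero hP
    (t := ∑ j : Fin k, (⟨x j, hxP j⟩ : P) ⊗ₜ[R] l j) (by
      simpa [Finset.sum_range] using h)
  obtain ⟨n, s, hs⟩ := Submodule.fg_iff_exists_fin_generating_family.1 hQ
  have hsQ : ∀ i, s i ∈ Q := fun i => hs ▸ Submodule.subset_span ⟨i, rfl⟩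
  let m : Fin k ⊕ Fin n → Q :=
    Sum.elim (fun j => ⟨x j, hPQ (hxP j)⟩) (fun j => ⟨s j, hsQ j⟩)
  let l' : Fin k ⊕ Fin n → L := Sum.elim (fun j => l j) (fun _ => 0)
  have hm : Submodule.span R (Set.range m) = ⊤ := by
    apply Submodule.map_injective_of_injective (Submodule.injective_subtype Q)
    rw [Submodule.map_span, Submodule.map_top, Submodule.range_subtype]
    apply le_antisymm
    · rw [Submodule.span_le]
      rintro _ ⟨q, -, rfl⟩
      exact q.2
    · conv_lhs => rw [← hs]
      apply Submodule.span_mono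
      rintro _ ⟨i, rfl⟩
      exact ⟨m (Sum.inr i), ⟨_, rfl⟩, rfl⟩
  obtain ⟨t, a, w, h1, h2⟩ := TensorProduct.vanishesTrivially_of_sum_tmul_eq_zero R
    (m := m) (n := l') hm (by
      simp only [Fintype.sum_sum_type, m, l', Sum.elim_inl, Sum.elim_inr, TensorProduct.tmul_zero,
        Finset.sum_const_zero, add_zero]
      simpa [Submodule.inclusion_apply] using h0)
  refine ⟨⟨Fin t, Fin n, inferInstance, inferInstance,
    fun i j => if h : j < k then a (Sum.inl ⟨j, h⟩) i else 0, fun i j => a (Sum.inr j) i⟩, ?_, ?_⟩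
  · refine ⟨s, fun i => ?_⟩
    have := congrArg Subtype.val (h2 i)
    simpa [Fintype.sum_sum_type, m, Finset.sum_range] using this
  · rintro X _ _ z ⟨y, hy⟩
    have := TensorProduct.sum_tmul_eq_zero_of_vanishesTrivially R
      (m := Sum.elim (fun j : Fin k => z j) y) (n := l') ⟨t, a, w, h1, fun j => by
        have := hy j
        simpa [Fintype.sum_sum_type, Finset.sum_range] using this⟩
    simpa [Fintype.sum_sum_type, l', Finset.sum_range] using this

lemma sum_tmul_aux {R : Type u} [CommRing R] {X : Type v} [AddCommGroup X] [Module R X]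
    {L : Type v} [AddCommGroup L] [Module R L] (θ : PPF R) (k : ℕ) (e : θ.eq → L) (z : ℕ → X) :
    ∑ j ∈ Finset.range k, z j ⊗ₜ[R] (∑ i, θ.a i j • e i) =
      ∑ i, (∑ j ∈ Finset.range k, θ.a i j • z j) ⊗ₜ[R] e i := by
  simp only [TensorProduct.tmul_sum, TensorProduct.sum_tmul, TensorProduct.smul_tmul]
  rw [Finset.sum_comm]

/-- pp-types of tuples in Mittag-Leffler modules are finitely generated (relative to `N`). -/
lemma ml_type {R : Type u} [CommRing R] {M : Type v} [AddCommGroup M] [Module R M]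
    (hml : IsMittagLeffler R M) (N : Type v) [AddCommGroup N] [Module R N] (k : ℕ) (x : ℕ → M) :
    ∃ φ : PPF R, φ.Sat k x ∧ ∀ θ : PPF R, θ.Sat k x → ∀ z : ℕ → N, φ.Sat k z → θ.Sat k z := by
  let ι : Type v := {S : Set (ℕ → N) // ∃ θ : PPF R, θ.Sat k x ∧ S = {z | θ.Sat k z}}
  have hι : ∀ i : ι, ∃ θ : PPF R, θ.Sat k x ∧ i.1 = {z | θ.Sat k z} := fun i => i.2
  choose Θ hΘ hΘS using hι
  choose L i1 i2 e he H using fun i : ι => exists_test_module R N (Θ i).b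
  let l : ℕ → ∀ i, L i := fun j i => ∑ q, (Θ i).a q j • e i q
  have hz : ∑ j ∈ Finset.range k, x j ⊗ₜ[R] l j = 0 := by
    apply hml ι L
    rw [map_zero]
    ext i
    simp only [canonicalTensorPi, map_sum, Finset.sum_apply, LinearMap.pi_apply,
      LinearMap.lTensor_tmul, LinearMap.proj_apply, Pi.zero_apply, l]
    rw [sum_tmul_aux]
    obtain ⟨y, hy⟩ := hΘ i
    have : ∀ q, ∑ j ∈ Finset.range k, (Θ i).a q j • x j = - ∑ j, (Θ i).b q j • y j :=
      fun q => eq_neg_of_add_eq_zero_left (hy q)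
    simp only [this, TensorProduct.neg_tmul, Finset.sum_neg_distrib, TensorProduct.sum_tmul,
      TensorProduct.smul_tmul]
    rw [Finset.sum_comm]
    simp only [← TensorProduct.tmul_sum, he, TensorProduct.tmul_zero, Finset.sum_const_zero,
      neg_zero]
  obtain ⟨φ, hφ, hφ'⟩ := tensor_zero_formula k x l hz
  refine ⟨φ, hφ, fun θ hθ z hzφ => ?_⟩
  let i : ι := ⟨{z | θ.Sat k z}, θ, hθ, rfl⟩
  suffices (Θ i).Sat k z by
    have h2 : z ∈ i.1 := by rw [hΘS i]; exact this
    exact h2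
  have h0 := congrArg (LinearMap.lTensor N (LinearMap.proj (R := R) (φ := L) i)) (hφ' N z hzφ)
  simp only [map_sum, LinearMap.lTensor_tmul, LinearMap.proj_apply, map_zero, l] at h0
  rw [sum_tmul_aux] at h0
  obtain ⟨y, hy⟩ := H i _ h0
  refine ⟨fun j => - y j, fun q => ?_⟩
  simp only [smul_neg, Finset.sum_neg_distrib]
  rw [hy q, add_neg_cancel]

theorem countably_generated_mittagLeffler_is_pureProjective
    (R : Type u) [CommRing R] (M : Type v) [AddCommGroup M] [Module R M]
    (hcg : ∃ S : Set M, S.Countable ∧ Submodule.span R S = ⊤)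
    (hml : IsMittagLeffler R M) :
    IsPureProjective R M := by
  intro N _ _ f hf
  obtain ⟨S, hS, hspan⟩ := hcg
  obtain ⟨x, hx⟩ := (hS.insert (0 : M)).exists_eq_range (Set.insert_nonempty _ _)
  have hxspan : Submodule.span R (Set.range x) = ⊤ := by
    rw [← hx, eq_top_iff, ← hspan]
    exact Submodule.span_mono (Set.subset_insert _ _)
  choose φ hφ hφN using fun k => ml_type hml N k x
  have hK := hf.2
  have step : ∀ (k : ℕ) (z : ℕ → N), ((φ k).Sat k z ∧ ∀ i < k, f (z i) = x i) →
      ∃ z' : ℕ → N, ((φ (k+1)).Sat (k+1) z' ∧ ∀ i < k+1, f (z' i) = x i) ∧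
        ∀ i < k, z' i = z i := by
    rintro k z ⟨hz, hfz⟩
    obtain ⟨w, hw, hwφ⟩ := pure_lift hf _ _ _ (hφ (k+1))
    have hwk : (φ k).Sat k w := by
      rw [← PPF.sat_weaken]
      exact hφN (k+1) _ ((PPF.sat_weaken _ _).2 (hφ k)) w hwφ
    let d : ℕ → LinearMap.ker f := fun i =>
      if h : i < k then ⟨w i - z i, by simp [LinearMap.mem_ker, hw, hfz i h]⟩ else 0
    have hd : ∀ i < k, (d i : N) = w i - z i := fun i hi => by simp [d, hi]
    have hdN : (φ k).Sat k (fun i => (d i : N)) :=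
      (hwk.sub hz).congr fun i hi => (hd i hi).symm
    have hex : ((φ (k+1)).ex k).Sat k x := by
      rw [PPF.sat_ex]
      exact ⟨x k, by simpa using hφ (k+1)⟩
    have hdK := pure_sat hK _ _ d (hφN k _ hex _ hdN)
    rw [PPF.sat_ex] at hdK
    obtain ⟨e, he⟩ := hdK
    have he' := he.map (LinearMap.ker f).subtype
    refine ⟨_, ⟨hwφ.sub he', ?_⟩, ?_⟩
    · intro i _
      rw [map_sub, hw]
      simp
    · intro i hi
      simp [Function.update_of_ne hi.ne, hd i hi]
  choose! nxt hn1 hn2 using step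
  obtain ⟨z0, -, hz0⟩ := pure_lift hf _ _ _ (hφ 0)
  let s : ℕ → ℕ → N := fun k => Nat.rec z0 (fun k z => nxt k z) k
  have hs : ∀ k, (φ k).Sat k (s k) ∧ ∀ i < k, f (s k i) = x i := by
    intro k
    induction k with
    | zero => exact ⟨hz0, by simp⟩
    | succ k ih => exact hn1 k (s k) ih
  have hs2 : ∀ k, ∀ i < k, s (k+1) i = s k i := fun k => hn2 k (s k) (hs k)
  let g : ℕ → N := fun i => s (i+1) i
  have hsg : ∀ k, ∀ i < k, s k i = g i := by
    intro k i hi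
    induction k, hi using Nat.le_induction with
    | base => rfl
    | succ k hk ih => rw [hs2 k i hk, ih]
  have hgS : ∀ k, (φ k).Sat k g := fun k => (hs k).1.congr (hsg k)
  have hfg : ∀ i, f (g i) = x i := fun i => (hs (i+1)).2 i (Nat.lt_succ_self i)
  let p : (ℕ →₀ R) →ₗ[R] M := Finsupp.linearCombination R x
  let q : (ℕ →₀ R) →ₗ[R] N := Finsupp.linearCombination R g
  have hp : Function.Surjective p := by
    rw [← LinearMap.range_eq_top, Finsupp.range_linearCombination, hxspan]
  have hfq : f ∘ₗ q = p := by
    ext i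
    simp [p, q, hfg]
  have hker : LinearMap.ker p ≤ LinearMap.ker q := by
    intro r hr
    rw [LinearMap.mem_ker] at hr ⊢
    obtain ⟨k, hk⟩ := r.support.exists_nat_subset_range
    let θ : PPF R := ⟨Unit, Empty, inferInstance, inferInstance, fun _ j => r j, fun _ _ => 0⟩
    have hθ : ∀ (X : Type v) [AddCommGroup X] [Module R X] (y : ℕ → X),
        θ.Sat k y ↔ Finsupp.linearCombination R y r = 0 := by
      intro X _ _ y
      rw [Finsupp.linearCombination_apply, Finsupp.sum_of_support_subset r hk _ (by simp)]
      constructor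
      · rintro ⟨_, h⟩
        simpa [θ] using h ()
      · intro h
        exact ⟨fun e => e.elim, fun _ => by simpa [θ] using h⟩
    exact (hθ N g).1 (hφN k θ ((hθ M x).2 hr) g (hgS k))
  refine ⟨(LinearMap.ker p).liftQ q hker ∘ₗ (p.quotKerEquivOfSurjective hp).symm.toLinearMap, ?_⟩
  ext m
  obtain ⟨r, rfl⟩ := hp m
  have h1 : (p.quotKerEquivOfSurjective hp).symm (p r) = Submodule.Quotient.mk r := by
    rw [LinearEquiv.symm_apply_eq]
    rfl
  simp only [LinearMap.comp_apply, LinearEquiv.coe_coe, h1, LinearMap.id_apply]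
  exact LinearMap.congr_fun hfq r
end

section
/- Let 𝒟 be a definable subcategory of Mod-R. If i : D' → D is a pure monomorphism with D, D' ∈ 𝒟, f : D' → M a morphism with M ∈ 𝒟, and Y is the pushout of i along f, then Y ∈ 𝒟. -/
open TensorProduct

universe u v

/-- A class of modules (closed under isomorphism) is definable if it is closed under
direct products, direct limits and pure submodules. -/
def IsDefinableClass (R : Type u) [CommRing R]
    (D : (M : Type v) → [AddCommGroup M] → [Module R M] → Prop) : Prop :=
  (∀ (M N : Type v) [AddCommGroup M] [Module R M] [AddCommGroup N] [Module R N],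
      (M ≃ₗ[R] N) → D M → D N) ∧
  (∀ (ι : Type v) (L : ι → Type v) [∀ i, AddCommGroup (L i)] [∀ i, Module R (L i)],
      (∀ i, D (L i)) → D (∀ i, L i)) ∧
  (∀ (ι : Type v) [Preorder ι] [IsDirected ι (· ≤ ·)] [Nonempty ι] [DecidableEq ι]
      (G : ι → Type v) [∀ i, AddCommGroup (G i)] [∀ i, Module R (G i)]
      (f : ∀ i j, i ≤ j → G i →ₗ[R] G j) [DirectedSystem G (fun i j h => f i j h)],
      (∀ i, D (G i)) → D (Module.DirectLimit G f)) ∧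
  (∀ (M : Type v) [AddCommGroup M] [Module R M] (N : Submodule R M),
      IsPureSubmodule R M N → D M → D N)

/-- An injective map is a pure monomorphism if it remains injective after tensoring
with any module. -/
def IsPureMono (R : Type u) [CommRing R]
    {N : Type v} [AddCommGroup N] [Module R N] {M : Type v} [AddCommGroup M] [Module R M]
    (i : N →ₗ[R] M) : Prop :=
  Function.Injective i ∧
    ∀ (L : Type v) [AddCommGroup L] [Module R L],
      Function.Injective (LinearMap.rTensor L i)

universe w

namespace PurePushout

/-- Purity tested in universe `v` implies purity in all universes. -/
theorem rTensor_injective_of_small {R : Type u} [CommRing R]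
    {A B : Type v} [AddCommGroup A] [Module R A] [AddCommGroup B] [Module R B]
    (g : A →ₗ[R] B)
    (hg : ∀ (L : Type v) [AddCommGroup L] [Module R L], Function.Injective (g.rTensor L))
    (L : Type w) [AddCommGroup L] [Module R L] : Function.Injective (g.rTensor L) := by
  rw [rTensor_injective_iff_lcomp_surjective]
  intro φ
  let ev : A →ₗ[R] CharacterModule (CharacterModule A) :=
    { toFun := fun a => (AddMonoidHom.eval a : (A →+ AddCircle (1 : ℚ)) →+ AddCircle (1 : ℚ))
      map_add' := fun a b => by
        refine CharacterModule.ext _ fun c => ?_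
        exact AddMonoidHom.map_add c a b
      map_smul' := fun r a => rfl }
  obtain ⟨h, hh⟩ := rTensor_injective_iff_lcomp_surjective.1 (hg (CharacterModule A)) ev
  let ψ : L →ₗ[R] CharacterModule A :=
    { toFun := fun l => (AddMonoidHom.mk' (fun a => φ a l) fun a b => by
        rw [map_add]; rfl : A →+ AddCircle (1 : ℚ))
      map_add' := fun a b => by
        refine CharacterModule.ext _ fun c => ?_
        exact AddMonoidHom.map_add (φ c) a b
      map_smul' := fun r a => by
        refine CharacterModule.ext _ fun c => ?_
        change φ c (r • a) = φ (r • c) a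
        rw [LinearMap.map_smul φ r c]; rfl }
  refine ⟨CharacterModule.dual ψ ∘ₗ h, ?_⟩
  ext a l
  have := congrArg (fun k => k (ψ l)) (LinearMap.congr_fun hh a)
  exact this

/-- Lifting finitely many relations through a pure quotient. -/
theorem exists_lift {R : Type u} [CommRing R]
    {M : Type v} [AddCommGroup M] [Module R M] (N : Submodule R M)
    (hN : IsPureSubmodule R M N) {K : Type w} [Fintype K] [DecidableEq K]
    (a : K → ((M ⧸ N) →₀ R)) (ha : ∀ k, Finsupp.linearCombination R id (a k) = 0) :
    ∃ s : M ⧸ N → M, (∀ q, N.mkQ (s q) = q) ∧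
      ∀ k, Finsupp.linearCombination R s (a k) = 0 := by
  choose m hm using N.mkQ_surjective
  have hν : ∀ k, Finsupp.linearCombination R m (a k) ∈ N := by
    intro k
    rw [← Submodule.Quotient.mk_eq_zero, ← Submodule.mkQ_apply,
      Finsupp.apply_linearCombination, ← ha k]
    congr 2
    funext q
    exact hm q
  let ν : K → N := fun k => ⟨_, hν k⟩
  let A : ((M ⧸ N) →₀ R) →ₗ[R] (K → R) :=
    LinearMap.pi fun k => Finsupp.linearCombination R (fun q => a k q)
  let C := (K → R) ⧸ LinearMap.range A
  let π : (K → R) →ₗ[R] C := (LinearMap.range A).mkQ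
  -- a linear identity
  have key : ∀ (P : Type v) [AddCommGroup P] [Module R P] (t : P ⊗[R] ((M ⧸ N) →₀ R)) (k : K),
      TensorProduct.rid R P ((LinearMap.proj k).lTensor P (A.lTensor P t)) =
      Finsupp.linearCombination R
        (fun q => TensorProduct.rid R P ((Finsupp.lapply q).lTensor P t)) (a k) := by
    intro P _ _ t k
    induction t with
    | zero => simp [Finsupp.linearCombination_apply]
    | add x y hx hy =>
      simp only [map_add, hx, hy, Finsupp.linearCombination_apply, smul_add, Finsupp.sum_add]
    | tmul p x =>
      simp only [LinearMap.lTensor_tmul, TensorProduct.rid_tmul]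
      simp only [A, LinearMap.proj_apply, LinearMap.pi_apply]
      induction x using Finsupp.induction_linear with
      | zero => simp [Finsupp.linearCombination_apply]
      | add x y hx hy =>
        rw [map_add, add_smul, hx, hy]
        simp only [map_add, add_smul, Finsupp.linearCombination_apply, smul_add,
          Finsupp.sum_add]
      | single q r =>
        classical
        rw [Finsupp.linearCombination_single, Finsupp.linearCombination_apply, Finsupp.sum,
          Finset.sum_eq_single q]
        · simp [smul_smul, mul_comm]
        · intro b _ hb
          simp [hb.symm]
        · intro hq
          simp [Finsupp.notMem_support_iff.1 hq]
  let z : N ⊗[R] (K → R) := ∑ k, ν k ⊗ₜ[R] Pi.single k (1 : R)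
  have hz0 : (N.subtype).rTensor C (π.lTensor N z) = 0 := by
    have e1 : (N.subtype).rTensor C (π.lTensor N z) =
        ∑ k, Finsupp.linearCombination R m (a k) ⊗ₜ[R] π (Pi.single k (1 : R)) := by
      simp [z, ν]
    rw [e1]
    classical
    let S : Finset (M ⧸ N) := Finset.univ.biUnion fun k => (a k).support
    have e2 : ∀ k, Finsupp.linearCombination R m (a k) = ∑ q ∈ S, a k q • m q := by
      intro k
      rw [Finsupp.linearCombination_apply]
      refine Finsupp.sum_of_support_subset _ ?_ _ (by simp)
      exact Finset.subset_biUnion_of_mem (fun k => (a k).support) (Finset.mem_univ k)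
    simp only [e2, TensorProduct.sum_tmul, TensorProduct.smul_tmul]
    rw [Finset.sum_comm]
    refine Finset.sum_eq_zero fun q _ => ?_
    rw [← TensorProduct.tmul_sum]
    have : ∑ k, a k q • π (Pi.single k (1 : R)) = 0 := by
      simp only [← map_smul, ← map_sum]
      refine (Submodule.Quotient.mk_eq_zero _).2 ⟨Finsupp.single q 1, ?_⟩
      funext k
      simp [A, Finset.sum_apply, Pi.single_apply]
    rw [this, TensorProduct.tmul_zero]
  have hz1 : π.lTensor N z = 0 := by
    apply rTensor_injective_of_small N.subtype hN C
    rw [hz0, map_zero]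
  have hex : Function.Exact A π := by
    rw [LinearMap.exact_iff]
    exact Submodule.ker_mkQ _
  obtain ⟨t, ht⟩ := (lTensor_exact N hex (Submodule.mkQ_surjective _) z).1 hz1
  refine ⟨fun q => m q - (TensorProduct.rid R N ((Finsupp.lapply q).lTensor N t) : N), ?_, ?_⟩
  · intro q
    rw [map_sub, hm]
    simp
  · intro k
    have h1 := key N t k
    rw [ht] at h1
    have h2 : TensorProduct.rid R N ((LinearMap.proj k).lTensor N z) = ν k := by
      simp [z, Pi.single_apply]
    rw [h2] at h1
    have h3 := congrArg N.subtype h1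
    rw [Finsupp.apply_linearCombination] at h3
    have h4 : N.subtype (ν k) = Finsupp.linearCombination R m (a k) := rfl
    rw [h4] at h3
    simp only [Finsupp.linearCombination_apply, smul_sub, Finsupp.sum_sub] at h3 ⊢
    rw [h3, sub_eq_zero]
    rfl

theorem isPureSubmodule_range {R : Type u} [CommRing R]
    {A B : Type v} [AddCommGroup A] [Module R A] [AddCommGroup B] [Module R B]
    (g : A →ₗ[R] B)
    (hg : ∀ (L : Type v) [AddCommGroup L] [Module R L], Function.Injective (g.rTensor L)) :
    IsPureSubmodule R B (LinearMap.range g) := by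
  intro L _ _
  have hs : Function.Surjective (g.rangeRestrict.rTensor L) :=
    LinearMap.rTensor_surjective L g.surjective_rangeRestrict
  refine Function.Injective.of_comp_right ?_ hs
  rw [← LinearMap.coe_comp, ← LinearMap.rTensor_comp]
  exact hg L

section RP

variable (R : Type u) [CommRing R] (J : Type v) [Preorder J]

/-- Functions on the tail of `j`. -/
abbrev Tail (A : Type v) (j : J) : Type v := {k : J // j ≤ k} → A

/-- Restriction to smaller tails. -/
def res (A : Type v) [AddCommGroup A] [Module R A] (i j : J) (h : i ≤ j) :
    Tail J A i →ₗ[R] Tail J A j :=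
  LinearMap.funLeft R A (fun k => ⟨k.1, h.trans k.2⟩)

instance (A : Type v) [AddCommGroup A] [Module R A] :
    DirectedSystem (Tail J A) (fun i j h => res R J A i j h) where
  map_self _ _ := rfl
  map_map _ _ _ _ _ _ := rfl

/-- Diagonal. -/
def diag (A : Type v) [AddCommGroup A] [Module R A] (j : J) : A →ₗ[R] Tail J A j :=
  LinearMap.pi fun _ => LinearMap.id

theorem diag_injective [IsDirected J (· ≤ ·)] [DecidableEq J]
    (A : Type v) [AddCommGroup A] [Module R A] (j : J)
    (L : Type w) [AddCommGroup L] [Module R L] :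
    Function.Injective
      ((Module.DirectLimit.of R J (Tail J A) (res R J A) j ∘ₗ diag R J A j).rTensor L) := by
  rw [injective_iff_map_eq_zero]
  intro t ht
  rw [LinearMap.rTensor_comp, LinearMap.comp_apply] at ht
  have h1 := congrArg (TensorProduct.directLimitLeft (res R J A) L) ht
  rw [TensorProduct.directLimitLeft_rTensor_of, map_zero] at h1
  obtain ⟨k, hk, h2⟩ := Module.DirectLimit.of.zero_exact h1
  have h3 := congrArg
    ((LinearMap.proj (⟨k, le_rfl⟩ : {l : J // k ≤ l}) : Tail J A k →ₗ[R] A).rTensor L) h2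
  rw [map_zero, ← LinearMap.comp_apply, ← LinearMap.comp_apply, ← LinearMap.rTensor_comp,
    ← LinearMap.rTensor_comp] at h3
  have h4 : ((LinearMap.proj (⟨k, le_rfl⟩ : {l : J // k ≤ l}) : Tail J A k →ₗ[R] A) ∘ₗ
      res R J A j k hk) ∘ₗ diag R J A j = LinearMap.id := rfl
  rw [h4, LinearMap.rTensor_id] at h3
  exact h3

/-- Functoriality of the reduced power. -/
noncomputable def mapTail [DecidableEq J] {A B : Type v} [AddCommGroup A] [Module R A]
    [AddCommGroup B] [Module R B] (g : A →ₗ[R] B) :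
    Module.DirectLimit (Tail J A) (res R J A) →ₗ[R] Module.DirectLimit (Tail J B) (res R J B) :=
  Module.DirectLimit.map (fun _ => LinearMap.pi fun k => g ∘ₗ LinearMap.proj k)
    (fun _ _ _ => rfl)

theorem mapTail_of [DecidableEq J] {A B : Type v} [AddCommGroup A] [Module R A]
    [AddCommGroup B] [Module R B] (g : A →ₗ[R] B) (j : J) (F : Tail J A j) :
    mapTail R J g (Module.DirectLimit.of R J (Tail J A) (res R J A) j F) =
      Module.DirectLimit.of R J (Tail J B) (res R J B) j (fun k => g (F k)) :=
  Module.DirectLimit.map_apply_of _ _ _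

end RP

set_option maxHeartbeats 1000000 in
theorem quotient_mem {R : Type u} [CommRing R]
    {D : (M : Type v) → [AddCommGroup M] → [Module R M] → Prop}
    (hD : IsDefinableClass R D)
    (M : Type v) [AddCommGroup M] [Module R M] (hM : D M) (N : Submodule R M)
    (hN : IsPureSubmodule R M N) : D (M ⧸ N) := by
  classical
  obtain ⟨hiso, hprod, hlim, hpure⟩ := hD
  let Q := M ⧸ N
  -- representatives of scalars
  let E := AddMonoid.End M
  let ac : R → E := fun r => Module.toAddMonoidEnd R M r
  let ρ : E → R := Function.invFun ac
  have hρM : ∀ (r : R) (x : M), ρ (ac r) • x = r • x := by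
    intro r x
    have : ac (ρ (ac r)) = ac r := Function.invFun_eq ⟨r, rfl⟩
    exact DFunLike.congr_fun this x
  have hρQ : ∀ (r : R) (q : Q), ρ (ac r) • q = r • q := by
    intro r q
    obtain ⟨x, rfl⟩ := N.mkQ_surjective q
    rw [← map_smul, hρM, map_smul]
  let X := (Q × Q) ⊕ (E × Q)
  let J := Finset X
  let rel : X → (Q →₀ R) := Sum.elim
    (fun p => Finsupp.single (p.1 + p.2) 1 - Finsupp.single p.1 1 - Finsupp.single p.2 1)
    (fun p => Finsupp.single (ρ p.1 • p.2) 1 - Finsupp.single p.2 (ρ p.1))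
  have hrel : ∀ x, Finsupp.linearCombination R (id : Q → Q) (rel x) = 0 := by
    rintro (p | p) <;> simp [rel]
  have hs : ∀ j : J, ∃ s : Q → M, (∀ q, N.mkQ (s q) = q) ∧
      ∀ k : j, Finsupp.linearCombination R s (rel k) = 0 := fun j =>
    exists_lift N hN (fun k : j => rel k) (fun k => hrel k)
  choose s hs1 hs2 using hs
  let DL := Module.DirectLimit (Tail J M) (res R J M)
  let of := Module.DirectLimit.of R J (Tail J M) (res R J M)
  have hof : ∀ (x : X) (F G : Tail J M ∅),
      (∀ k : {k : J // ∅ ≤ k}, x ∈ k.1 → F k = G k) → of ∅ F = of ∅ G := by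
    intro x F G h
    have hle : (∅ : J) ≤ {x} := Finset.empty_subset _
    have e : ∀ F, of {x} (res R J M ∅ {x} hle F) = of ∅ F := fun F => Module.DirectLimit.of_f
    rw [← e F, ← e G]
    congr 1
    funext k
    exact h _ (k.2 (Finset.mem_singleton_self x))
  let φ : Q →ₗ[R] DL :=
    { toFun := fun q => of ∅ (fun k => s k.1 q)
      map_add' := fun x y => by
        rw [← map_add]
        refine hof (Sum.inl (x, y)) _ _ fun k hk => ?_
        have := hs2 k.1 ⟨_, hk⟩
        simp only [rel, Sum.elim_inl, map_sub, Finsupp.linearCombination_single, one_smul] at this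
        rw [sub_sub, sub_eq_zero] at this
        exact this
      map_smul' := fun r x => by
        rw [RingHom.id_apply, ← map_smul]
        refine hof (Sum.inr (ac r, x)) _ _ fun k hk => ?_
        have := hs2 k.1 ⟨_, hk⟩
        simp only [rel, Sum.elim_inr, map_sub, Finsupp.linearCombination_single, one_smul] at this
        rw [sub_eq_zero, hρM, hρQ] at this
        exact this }
  let ψ : DL →ₗ[R] Module.DirectLimit (Tail J Q) (res R J Q) :=
    mapTail R J N.mkQ
  have hψφ : ψ ∘ₗ φ = Module.DirectLimit.of R J (Tail J Q) (res R J Q) ∅ ∘ₗ diag R J Q ∅ := by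
    refine LinearMap.ext fun q => ?_
    refine (mapTail_of R J N.mkQ ∅ (fun k => s k.1 q)).trans ?_
    rw [LinearMap.comp_apply]
    congr 1
    funext k
    exact hs1 k.1 q
  have hφ' : ∀ (L : Type v) [AddCommGroup L] [Module R L],
      Function.Injective (φ.rTensor L) := by
    intro L _ _
    have := diag_injective R J Q ∅ L
    rw [← hψφ, LinearMap.rTensor_comp, LinearMap.coe_comp] at this
    exact this.of_comp
  have hinj : Function.Injective φ := by
    rw [injective_iff_map_eq_zero]
    intro q hq
    have h1 : Module.DirectLimit.of R J (Tail J Q) (res R J Q) ∅ (diag R J Q ∅ q) = 0 := by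
      have := LinearMap.congr_fun hψφ q
      rw [LinearMap.comp_apply, hq, map_zero] at this
      exact this.symm
    obtain ⟨k, hk, h2⟩ := Module.DirectLimit.of.zero_exact h1
    exact congrFun h2 ⟨k, le_rfl⟩
  have hDL : D DL := hlim J (Tail J M) (res R J M) fun j => hprod _ _ fun _ => hM
  exact hiso _ _ (LinearEquiv.ofInjective φ hinj).symm
    (hpure DL (LinearMap.range φ) (isPureSubmodule_range φ hφ') hDL)

/-- Two-element family. -/
def Fam (A B : Type v) : ULift.{v} Bool → Type v
  | ⟨true⟩ => A
  | ⟨false⟩ => B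

instance famGroup (A B : Type v) [AddCommGroup A] [AddCommGroup B] :
    ∀ i, AddCommGroup (Fam A B i)
  | ⟨true⟩ => inferInstanceAs (AddCommGroup A)
  | ⟨false⟩ => inferInstanceAs (AddCommGroup B)

instance famModule (R : Type u) [CommRing R] (A B : Type v) [AddCommGroup A] [AddCommGroup B]
    [Module R A] [Module R B] : ∀ i, Module R (Fam A B i)
  | ⟨true⟩ => inferInstanceAs (Module R A)
  | ⟨false⟩ => inferInstanceAs (Module R B)

theorem prod_mem {R : Type u} [CommRing R]
    {D : (M : Type v) → [AddCommGroup M] → [Module R M] → Prop}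
    (hD : IsDefinableClass R D) (A B : Type v) [AddCommGroup A] [AddCommGroup B]
    [Module R A] [Module R B] (hA : D A) (hB : D B) : D (A × B) := by
  obtain ⟨hiso, hprod, -, -⟩ := hD
  have h := hprod (ULift.{v} Bool) (Fam A B) (by
    rintro ⟨_ | _⟩
    · exact hB
    · exact hA)
  refine hiso _ _ ?_ h
  exact
    { toFun := fun x => (x ⟨true⟩, x ⟨false⟩)
      map_add' := fun _ _ => rfl
      map_smul' := fun _ _ => rfl
      invFun := fun p i => match i with
        | ⟨true⟩ => p.1
        | ⟨false⟩ => p.2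
      left_inv := fun x => by
        funext i
        rcases i with ⟨_ | _⟩ <;> rfl
      right_inv := fun _ => rfl }

end PurePushout

theorem pushout_of_pureMono_mem_definableClass (R : Type u) [CommRing R]
    (D : (M : Type v) → [AddCommGroup M] → [Module R M] → Prop)
    (hD : IsDefinableClass R D)
    (M D' D₀ : Type v) [AddCommGroup M] [Module R M]
    [AddCommGroup D'] [Module R D'] [AddCommGroup D₀] [Module R D₀]
    (i : D' →ₗ[R] D₀) (f : D' →ₗ[R] M)
    (hM : D M) (hD' : D D') (hD₀ : D D₀) (hi : IsPureMono R i) :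
    D ((M × D₀) ⧸ LinearMap.range (LinearMap.prod f (-i))) := by
  refine PurePushout.quotient_mem hD _ (PurePushout.prod_mem hD _ _ hM hD₀) _ ?_
  refine PurePushout.isPureSubmodule_range _ ?_
  intro L _ _
  have h : i = (-LinearMap.snd R M D₀) ∘ₗ LinearMap.prod f (-i) := by
    ext x
    simp
  have h2 := hi.2 L
  rw [h, LinearMap.rTensor_comp, LinearMap.coe_comp] at h2
  exact h2.of_comp
end

section
/- Let T be a tilting R-module and 𝒟 = Gen(T) the class of T-generated modules. Then T is strictly 𝒟-atomic, and for some n the natural map R → T^n (coming from a 𝒟-preenvelope of R) is a 𝒟-preenvelope of R. -/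
open TensorProduct DirectSum

universe u v

/-- A pp formula in `n` free variables. -/
structure PPFormula (R : Type u) [Ring R] (n : ℕ) where
  k : ℕ
  m : ℕ
  A : Fin n → Fin m → R
  B : Fin k → Fin m → R

/-- The solution set of a pp formula in a module. -/
def PPFormula.sol {R : Type u} [Ring R] {n : ℕ} (φ : PPFormula R n)
    (M : Type v) [AddCommGroup M] [Module R M] : Set (Fin n → M) :=
  { a | ∃ b : Fin φ.k → M, ∀ j,
      (∑ i, φ.A i j • a i) + (∑ l, φ.B l j • b l) = 0 }

/-- `φ` generates the pp-type of the tuple `a` of `M` modulo the theory of `𝒟`. -/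
def DGenerates (R : Type u) [CommRing R]
    (D : (M : Type v) → [AddCommGroup M] → [Module R M] → Prop)
    {n : ℕ} (φ : PPFormula R n)
    (M : Type v) [AddCommGroup M] [Module R M] (a : Fin n → M) : Prop :=
  a ∈ φ.sol M ∧ ∀ ψ : PPFormula R n, a ∈ ψ.sol M →
    ∀ (N : Type v) [AddCommGroup N] [Module R N], D N → φ.sol N ⊆ ψ.sol N

/-- `M ∈ 𝒟` is `𝒟`-atomic: every pp-type realised in `M` is `𝒟`-finitely generated. -/
def IsDAtomic (R : Type u) [CommRing R]
    (D : (M : Type v) → [AddCommGroup M] → [Module R M] → Prop)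
    (M : Type v) [AddCommGroup M] [Module R M] : Prop :=
  D M ∧ ∀ (n : ℕ) (a : Fin n → M), ∃ φ : PPFormula R n, DGenerates R D φ M a

/-- `M ∈ 𝒟` is strictly `𝒟`-atomic: it is `𝒟`-atomic and whenever `φ` `𝒟`-generates
the pp-type of `ā` in `M`, every `b̄ ∈ φ(N)` with `N ∈ 𝒟` is the image of `ā` under a
morphism `M → N`. -/
def IsStrictlyDAtomic (R : Type u) [CommRing R]
    (D : (M : Type v) → [AddCommGroup M] → [Module R M] → Prop)
    (M : Type v) [AddCommGroup M] [Module R M] : Prop :=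
  IsDAtomic R D M ∧
    ∀ (n : ℕ) (a : Fin n → M) (φ : PPFormula R n), DGenerates R D φ M a →
      ∀ (N : Type v) [AddCommGroup N] [Module R N], D N →
        ∀ b ∈ φ.sol N, ∃ f : M →ₗ[R] N, ∀ i, f (a i) = b i

/-- `Ext¹(A, B) = 0`: every short exact sequence `0 → B → E → A → 0` splits. -/
def Ext1Vanishes (R : Type u) [CommRing R]
    (A : Type v) [AddCommGroup A] [Module R A]
    (B : Type v) [AddCommGroup B] [Module R B] : Prop :=
  ∀ (E : Type v) [AddCommGroup E] [Module R E] (i : B →ₗ[R] E) (p : E →ₗ[R] A),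
    Function.Injective i → Function.Surjective p →
    LinearMap.range i = LinearMap.ker p →
    ∃ s : A →ₗ[R] E, p.comp s = LinearMap.id

/-- `X ∈ Add T`: `X` is a direct summand of a direct sum of copies of `T`. -/
def InAdd (R : Type u) [CommRing R] (T : Type v) [AddCommGroup T] [Module R T]
    (X : Type v) [AddCommGroup X] [Module R X] : Prop :=
  ∃ (κ : Type v) (s : X →ₗ[R] (κ →₀ T)) (pr : (κ →₀ T) →ₗ[R] X),
    pr.comp s = LinearMap.id

/-- `X ∈ Gen T`: `X` is an epimorphic image of a direct sum of copies of `T`. -/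
def InGen (R : Type u) [CommRing R] (T : Type v) [AddCommGroup T] [Module R T]
    (X : Type v) [AddCommGroup X] [Module R X] : Prop :=
  ∃ (κ : Type v) (p : (κ →₀ T) →ₗ[R] X), Function.Surjective p

/-- `T` is a tilting module: `pdim T ≤ 1`, `Ext¹(T, T^{(κ)}) = 0` for every `κ`, and
there is an exact sequence `0 → R → T₀ → T₁ → 0` with `T₀, T₁ ∈ Add T`. -/
def IsTilting (R : Type u) [CommRing R] (T : Type v) [AddCommGroup T] [Module R T] : Prop :=
  (∃ (P₀ P₁ : Type v) (a₀ : AddCommGroup P₀) (a₁ : AddCommGroup P₁),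
    haveI := a₀; haveI := a₁
    ∃ (m₀ : Module R P₀) (m₁ : Module R P₁),
      haveI := m₀; haveI := m₁
      Module.Projective R P₀ ∧ Module.Projective R P₁ ∧
      ∃ (h : P₁ →ₗ[R] P₀) (g : P₀ →ₗ[R] T),
        Function.Injective h ∧ Function.Surjective g ∧
        LinearMap.range h = LinearMap.ker g) ∧
  (∀ κ : Type v, Ext1Vanishes R T (κ →₀ T)) ∧
  (∃ (T₀ T₁ : Type v) (a₀ : AddCommGroup T₀) (a₁ : AddCommGroup T₁),
    haveI := a₀; haveI := a₁
    ∃ (m₀ : Module R T₀) (m₁ : Module R T₁),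
      haveI := m₀; haveI := m₁
      InAdd R T T₀ ∧ InAdd R T T₁ ∧
      ∃ (i : R →ₗ[R] T₀) (p : T₀ →ₗ[R] T₁),
        Function.Injective i ∧ Function.Surjective p ∧
        LinearMap.range i = LinearMap.ker p)

/-- `f : A → D₀` is a `𝒟`-preenvelope of `A`. -/
def IsDPreenvelope (R : Type u) [CommRing R]
    (D : (M : Type v) → [AddCommGroup M] → [Module R M] → Prop)
    (A : Type v) [AddCommGroup A] [Module R A]
    (D₀ : Type v) [AddCommGroup D₀] [Module R D₀] (f : A →ₗ[R] D₀) : Prop :=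
  D D₀ ∧ ∀ (D' : Type v) [AddCommGroup D'] [Module R D'], D D' →
    ∀ g : A →ₗ[R] D', ∃ h : D₀ →ₗ[R] D', h.comp f = g

theorem aux_extend {R : Type u} [CommRing R] {A B C N : Type u}
    [AddCommGroup A] [Module R A] [AddCommGroup B] [Module R B]
    [AddCommGroup C] [Module R C] [AddCommGroup N] [Module R N]
    (hE : Ext1Vanishes R C N) (i : A →ₗ[R] B) (p : B →ₗ[R] C)
    (hi : Function.Injective i) (hp : Function.Surjective p)
    (hip : LinearMap.range i = LinearMap.ker p) (g : A →ₗ[R] N) :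
    ∃ g' : B →ₗ[R] N, g'.comp i = g := by
  have hpi : ∀ r, p (i r) = 0 := fun r => by
    have : i r ∈ LinearMap.ker p := hip ▸ LinearMap.mem_range_self i r
    simpa using this
  let Q : Submodule R (N × B) := LinearMap.range (g.prod (-i))
  let j : N →ₗ[R] (N × B) ⧸ Q := Q.mkQ.comp (LinearMap.inl R N B)
  let b : B →ₗ[R] (N × B) ⧸ Q := Q.mkQ.comp (LinearMap.inr R N B)
  have hQ : Q ≤ LinearMap.ker (p.comp (LinearMap.snd R N B)) := by
    rintro _ ⟨r, rfl⟩
    simp [hpi]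
  let q : ((N × B) ⧸ Q) →ₗ[R] C := Q.liftQ (p.comp (LinearMap.snd R N B)) hQ
  have hqmk : ∀ x : N × B, q (Q.mkQ x) = p x.2 := fun x => by
    simp [q]
  have hj : Function.Injective j := by
    rw [← LinearMap.ker_eq_bot, LinearMap.ker_eq_bot']
    intro m hm
    have : (m, (0 : B)) ∈ Q := by
      simpa [j] using hm
    obtain ⟨r, hr⟩ := this
    have hr1 : g r = m := congrArg Prod.fst hr
    have hr2 : -(i r) = 0 := congrArg Prod.snd hr
    have : r = 0 := hi (by rw [neg_eq_zero.mp hr2, map_zero])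
    rw [← hr1, this, map_zero]
  have hq : Function.Surjective q := fun c => by
    obtain ⟨x, rfl⟩ := hp c
    exact ⟨b x, hqmk _⟩
  have hbi : ∀ r, b (i r) = j (g r) := fun r => by
    have h1 : j (g r) - b (i r) = 0 := by
      have : j (g r) - b (i r) = Q.mkQ (g r, - i r) := by
        simp only [j, b, LinearMap.comp_apply, ← map_sub]
        congr 1
        simp
      rw [this, Submodule.mkQ_apply, Submodule.Quotient.mk_eq_zero]
      exact ⟨r, rfl⟩
    exact (sub_eq_zero.mp h1).symm
  have hex : LinearMap.range j = LinearMap.ker q := by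
    apply le_antisymm
    · rintro _ ⟨m, rfl⟩
      rw [LinearMap.mem_ker]
      exact (hqmk _).trans (by simp)
    · intro x hx
      obtain ⟨⟨m, y⟩, rfl⟩ := Q.mkQ_surjective x
      rw [LinearMap.mem_ker, hqmk] at hx
      have : y ∈ LinearMap.range i := by rw [hip]; exact hx
      obtain ⟨r, rfl⟩ := this
      refine ⟨m + g r, ?_⟩
      rw [map_add, ← hbi]
      simp only [j, b, LinearMap.comp_apply, ← map_add]
      congr 1
      simp
  obtain ⟨s, hs⟩ := hE _ j q hj hq hex
  have hs' : ∀ c, q (s c) = c := fun c => LinearMap.congr_fun hs c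
  let d : B →ₗ[R] ((N × B) ⧸ Q) := b - s.comp p
  have hd : ∀ x, d x ∈ LinearMap.range j := fun x => by
    rw [hex, LinearMap.mem_ker]
    have : q (b x) = p x := hqmk _
    simp [d, this, hs']
  let e := LinearEquiv.ofInjective j hj
  refine ⟨e.symm.toLinearMap.comp (d.codRestrict _ hd), ?_⟩
  ext r
  simp only [LinearMap.comp_apply, LinearEquiv.coe_coe]
  rw [LinearEquiv.symm_apply_eq]
  apply Subtype.ext
  simp [d, e, hpi, hbi]

theorem aux_ext_gen {R : Type u} [CommRing R] {T N : Type u}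
    [AddCommGroup T] [Module R T] [AddCommGroup N] [Module R N]
    (hT : IsTilting R T) (hN : InGen R T N) : Ext1Vanishes R T N := by
  obtain ⟨⟨P₀, P₁, a₀, a₁, m₀, m₁, hP₀, hP₁, h, g, hh, hg, hhg⟩, hext, -⟩ := hT
  obtain ⟨κ, c, hc⟩ := hN
  intro E _ _ j q hj hq hjq
  obtain ⟨l, hl⟩ := Module.projective_lifting_property q g hq
  have hgh : ∀ x, g (h x) = 0 := fun x => by
    have : h x ∈ LinearMap.ker g := hhg ▸ LinearMap.mem_range_self h x
    simpa using this
  have hd : ∀ x, l (h x) ∈ LinearMap.range j := fun x => by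
    rw [hjq, LinearMap.mem_ker]
    exact (LinearMap.congr_fun hl (h x)).trans (hgh x)
  let e := LinearEquiv.ofInjective j hj
  let k : P₁ →ₗ[R] N := e.symm.toLinearMap.comp ((l.comp h).codRestrict _ hd)
  have hk : ∀ x, j (k x) = l (h x) := fun x => by
    have : e (k x) = ⟨l (h x), hd x⟩ := by
      simp only [k, LinearMap.comp_apply, LinearEquiv.coe_coe, LinearEquiv.apply_symm_apply]
      rfl
    exact congrArg Subtype.val this
  obtain ⟨k', hk'⟩ := Module.projective_lifting_property c k hc
  obtain ⟨u, hu⟩ := aux_extend (hext κ) h g hh hg hhg k'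
  let v : P₀ →ₗ[R] E := l - j.comp (c.comp u)
  have hv : LinearMap.ker g ≤ LinearMap.ker v := by
    rw [← hhg]
    rintro _ ⟨x, rfl⟩
    have h1 : u (h x) = k' x := LinearMap.congr_fun hu x
    have h2 : c (k' x) = k x := LinearMap.congr_fun hk' x
    simp [v, h1, h2, hk]
  let e2 := g.quotKerEquivOfSurjective hg
  refine ⟨((LinearMap.ker g).liftQ v hv).comp e2.symm.toLinearMap, ?_⟩
  ext t
  obtain ⟨x, rfl⟩ := hg t
  have hx : e2.symm (g x) = (LinearMap.ker g).mkQ x := by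
    rw [LinearEquiv.symm_apply_eq]; rfl
  have h3 : q (l x) = g x := LinearMap.congr_fun hl x
  have h4 : ∀ y, q (j y) = 0 := fun y => by
    have : j y ∈ LinearMap.ker q := hjq ▸ LinearMap.mem_range_self j y
    simpa using this
  simp only [LinearMap.comp_apply, LinearEquiv.coe_coe, hx, Submodule.mkQ_apply,
    Submodule.liftQ_apply, LinearMap.id_apply]
  simp [v, h3, h4]

theorem aux_ext_add {R : Type u} [CommRing R] {T N X : Type u}
    [AddCommGroup T] [Module R T] [AddCommGroup N] [Module R N]
    [AddCommGroup X] [Module R X]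
    (hTN : Ext1Vanishes R T N) (hX : InAdd R T X) : Ext1Vanishes R X N := by
  obtain ⟨κ, s, pr, hs⟩ := hX
  intro E _ _ j q hj hq hjq
  have hqj : ∀ y, q (j y) = 0 := fun y => by
    have : j y ∈ LinearMap.ker q := hjq ▸ LinearMap.mem_range_self j y
    simpa using this
  have key : ∀ t : T →ₗ[R] X, ∃ t' : T →ₗ[R] E, q.comp t' = t := by
    intro t
    let W : Submodule R (E × T) :=
      LinearMap.ker (q.comp (LinearMap.fst R E T) - t.comp (LinearMap.snd R E T))
    have hW : ∀ x : E × T, x ∈ W ↔ q x.1 = t x.2 := fun x => by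
      simp [W, sub_eq_zero]
    let j' : N →ₗ[R] W := ((LinearMap.inl R E T).comp j).codRestrict W
      (fun y => by rw [hW]; simp [hqj])
    let q' : W →ₗ[R] T := (LinearMap.snd R E T).comp W.subtype
    obtain ⟨σ, hσ⟩ := hTN W j' q' (by
        intro x y hxy
        apply hj
        exact congrArg (fun z : W => z.1.1) hxy) (by
        intro x
        obtain ⟨e, he⟩ := hq (t x)
        exact ⟨⟨(e, x), (hW _).2 he⟩, rfl⟩) (by
        apply le_antisymm
        · rintro _ ⟨y, rfl⟩
          rfl
        · rintro ⟨⟨e, x⟩, hex⟩ hx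
          have hx0 : x = 0 := hx
          subst hx0
          have he : q e = 0 := by simpa using (hW _).1 hex
          have : e ∈ LinearMap.range j := by rw [hjq]; exact he
          obtain ⟨y, rfl⟩ := this
          exact ⟨y, rfl⟩)
    refine ⟨(LinearMap.fst R E T).comp (W.subtype.comp σ), ?_⟩
    ext x
    have h1 := (hW (σ x).1).1 (σ x).2
    have h2 : (σ x).1.2 = x := LinearMap.congr_fun hσ x
    rw [h2] at h1
    exact h1
  choose L hL using key
  let M : (κ →₀ T) →ₗ[R] E := Finsupp.lsum ℕ (fun k => L (pr.comp (Finsupp.lsingle k)))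
  have hM : q.comp M = pr := by
    ext k x
    have := LinearMap.congr_fun (hL (pr.comp (Finsupp.lsingle k))) x
    simpa [M] using this
  refine ⟨M.comp s, ?_⟩
  rw [← LinearMap.comp_assoc, hM, hs]

theorem aux_gen {R : Type u} [CommRing R] {T X : Type u}
    [AddCommGroup T] [Module R T] [AddCommGroup X] [Module R X] (n : ℕ)
    (H : ∀ x : X, ∃ h : (Fin n → T) →ₗ[R] X, x ∈ LinearMap.range h) : InGen R T X := by
  refine ⟨((Fin n → T) →ₗ[R] X) × Fin n,
    Finsupp.lsum ℕ (fun k => k.1.comp (LinearMap.single R (fun _ => T) k.2)), ?_⟩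
  intro x
  obtain ⟨h, y, rfl⟩ := H x
  refine ⟨∑ i, Finsupp.single (h, i) (y i), ?_⟩
  rw [map_sum]
  simp only [Finsupp.lsum_single, LinearMap.comp_apply, LinearMap.coe_single]
  rw [← map_sum, Finset.univ_sum_single]

theorem aux_preenv {R : Type u} [CommRing R] {T : Type u}
    [AddCommGroup T] [Module R T] (hT : IsTilting R T) :
    ∃ (n : ℕ) (f : R →ₗ[R] (Fin n → T)),
        IsDPreenvelope R (InGen R T) R (Fin n → T) f := by
  have hT' := hT
  obtain ⟨-, -, T₀, T₁, a₀, a₁, m₀, m₁, ⟨κ, s, pr, hs⟩, hT₁, i, p, hi, hp, hip⟩ := hT'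
  let z := s (i 1)
  let e := z.support.equivFin
  refine ⟨z.support.card,
    LinearMap.toSpanSingleton R _ (fun j => z (e.symm j)), ?_, ?_⟩
  · exact aux_gen _ (fun x => ⟨LinearMap.id, x, rfl⟩)
  · intro N _ _ hN g
    obtain ⟨h0, hh0⟩ := aux_extend (aux_ext_add (aux_ext_gen hT hN) hT₁) i p hi hp hip g
    refine ⟨∑ j, (h0.comp (pr.comp (Finsupp.lsingle (e.symm j : κ)))).comp
      (LinearMap.proj j), ?_⟩
    apply LinearMap.ext_ring
    have h1 : h0 (pr z) = g 1 := by
      rw [← hh0]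
      exact congrArg h0 (LinearMap.congr_fun hs (i 1))
    rw [← h1]
    have h2 : z = ∑ j, Finsupp.single (e.symm j : κ) (z (e.symm j)) := by
      rw [Equiv.sum_comp e.symm (fun k : z.support => Finsupp.single (k : κ) (z k))]
      conv_lhs => rw [← Finsupp.sum_single z]
      rw [Finsupp.sum, ← Finset.sum_coe_sort]
    conv_rhs => rw [h2]
    simp [LinearMap.sum_apply]

theorem aux_pp {R : Type u} [CommRing R] {n : ℕ} {α β : Type*} [Fintype α] [Fintype β]
    (A : Fin n → α → R) (B : β → α → R) :
    ∃ φ : PPFormula R n, ∀ (N : Type u) [AddCommGroup N] [Module R N] (b : Fin n → N),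
      b ∈ φ.sol N ↔ ∃ y : β → N, ∀ j, (∑ i, A i j • b i) + (∑ l, B l j • y l) = 0 := by
  let ea := Fintype.equivFin α
  let eb := Fintype.equivFin β
  refine ⟨⟨Fintype.card β, Fintype.card α, fun i j => A i (ea.symm j),
    fun l j => B (eb.symm l) (ea.symm j)⟩, ?_⟩
  intro N _ _ b
  constructor
  · rintro ⟨y, hy⟩
    refine ⟨fun l => y (eb l), fun j => ?_⟩
    have := hy (ea j)
    simp only [Equiv.symm_apply_apply] at this
    rw [← this, ← Equiv.sum_comp eb]
    simp
  · rintro ⟨y, hy⟩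
    refine ⟨fun l => y (eb.symm l), fun j => ?_⟩
    have := hy (ea.symm j)
    rw [← this]
    congr 1
    exact Equiv.sum_comp eb.symm (fun l => B l (ea.symm j) • y l)

theorem aux_pp_fin {R : Type u} [CommRing R] {J : Type u} {n : ℕ} (w : Fin n → J)
    (S : Finset (J →₀ R)) :
    ∃ φ : PPFormula R n, ∀ (N : Type u) [AddCommGroup N] [Module R N] (b : Fin n → N),
      b ∈ φ.sol N ↔ ∃ g : (J →₀ R) →ₗ[R] N, (∀ s ∈ S, g s = 0) ∧
        ∀ i, g (Finsupp.single (w i) 1) = b i := by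
  classical
  let V : Finset J := S.biUnion (fun s => s.support) ∪ Finset.univ.image w
  have hSV : ∀ s ∈ S, s.support ⊆ V := fun s hs =>
    (Finset.subset_biUnion_of_mem (fun s : J →₀ R => s.support) hs).trans
      Finset.subset_union_left
  have hwV : ∀ i, w i ∈ V := fun i =>
    Finset.mem_union_right _ (Finset.mem_image_of_mem _ (Finset.mem_univ i))
  obtain ⟨φ, hφ⟩ := aux_pp (R := R) (n := n) (α := S ⊕ Fin n) (β := V)
    (fun i j => Sum.elim (fun _ => 0) (fun i' => if i = i' then -1 else 0) j)
    (fun l j => Sum.elim (fun s => s.1 l) (fun i' => if (l : J) = w i' then 1 else 0) j)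
  have hsum : ∀ (N : Type u) [AddCommGroup N] [Module R N] (y : J → N) (s : J →₀ R),
      s ∈ S → Finsupp.linearCombination R y s = ∑ l : V, s l • y l := by
    intro N _ _ y s hs
    rw [Finsupp.linearCombination_apply, Finsupp.sum_of_support_subset s (hSV s hs) _ (by simp),
      ← Finset.sum_coe_sort]
  have hsing : ∀ (N : Type u) [AddCommGroup N] [Module R N] (y : V → N) (i : Fin n),
      (∑ l : V, (if (l : J) = w i then (1 : R) else 0) • y l) = y ⟨w i, hwV i⟩ := by
    intro N _ _ y i
    rw [Finset.sum_eq_single ⟨w i, hwV i⟩]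
    · simp
    · intro l _ hl
      rw [if_neg, zero_smul]
      intro h
      exact hl (Subtype.ext h)
    · simp
  refine ⟨φ, fun N _ _ b => ?_⟩
  rw [hφ]
  constructor
  · rintro ⟨y, hy⟩
    let y' : J → N := fun t => if h : t ∈ V then y ⟨t, h⟩ else 0
    have hy' : ∀ l : V, y' l = y l := fun l => by simp [y']
    refine ⟨Finsupp.linearCombination R y', fun s hs => ?_, fun i => ?_⟩
    · rw [hsum N y' s hs]
      have := hy (Sum.inl ⟨s, hs⟩)
      simpa [hy'] using this
    · have := hy (Sum.inr i)
      simp only [Sum.elim_inr] at this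
      rw [hsing] at this
      have h2 : y' (w i) = y ⟨w i, hwV i⟩ := hy' ⟨w i, hwV i⟩
      rw [Finsupp.linearCombination_single, one_smul, h2]
      simp only [ite_smul, zero_smul, neg_smul, one_smul, Finset.sum_ite_eq',
        Finset.mem_univ, if_true] at this
      exact (neg_add_eq_zero.mp this).symm
  · rintro ⟨g, hg, hgw⟩
    let y : J → N := fun t => g (Finsupp.single t 1)
    have hgy : g = Finsupp.linearCombination R y := by
      ext t
      simp [y]
    refine ⟨fun l => y l, ?_⟩
    rintro (⟨s, hs⟩ | i)
    · have := hsum N y s hs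
      rw [← hgy, hg s hs] at this
      simpa using this.symm
    · simp only [Sum.elim_inr]
      rw [hsing N (fun l : V => y l)]
      simp [y, hgw]

theorem aux_main {R : Type u} [CommRing R] {T : Type u}
    [AddCommGroup T] [Module R T] (hT : IsTilting R T) (n : ℕ) (a : Fin n → T) :
    ∃ φ : PPFormula R n, a ∈ φ.sol T ∧
      ∀ (N : Type u) [AddCommGroup N] [Module R N], InGen R T N →
        ∀ b ∈ φ.sol N, ∃ f : T →ₗ[R] N, ∀ i, f (a i) = b i := by
  classical
  let π : (T →₀ R) →ₗ[R] T := Finsupp.linearCombination R id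
  have hπ : Function.Surjective π := Finsupp.linearCombination_surjective R Function.surjective_id
  have hπa : ∀ i, π (Finsupp.single (a i) 1) = a i := fun i => by simp [π]
  let K := LinearMap.ker π
  choose φ hφ using fun S : Finset K =>
    aux_pp_fin (R := R) a (S.image (fun x : K => (x : T →₀ R)))
  have haφ : ∀ S, a ∈ (φ S).sol T := fun S => by
    rw [hφ]
    refine ⟨π, fun s hs => ?_, hπa⟩
    obtain ⟨x, -, rfl⟩ := Finset.mem_image.mp hs
    exact x.2
  by_contra hcon
  push Not at hcon
  choose N iN mN hN b hb hno using fun S => hcon (φ S) (haφ S)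
  choose g hgS hgw using fun S => (hφ S (N S) (b S)).1 (hb S)
  let N' : Submodule R (∀ S, N S) :=
    { carrier := {x | ∃ F : Finset K, ∀ S, F ⊆ S → x S = 0}
      zero_mem' := ⟨∅, fun _ _ => rfl⟩
      add_mem' := by
        rintro x y ⟨F, hF⟩ ⟨G, hG⟩
        refine ⟨F ∪ G, fun S hS => ?_⟩
        rw [Pi.add_apply, hF S (Finset.union_subset_left hS),
          hG S (Finset.union_subset_right hS), add_zero]
      smul_mem' := by
        rintro c x ⟨F, hF⟩
        exact ⟨F, fun S hS => by rw [Pi.smul_apply, hF S hS, smul_zero]⟩ }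
  have hN' : InGen R T N' := by
    obtain ⟨m, f, -, hf⟩ := aux_preenv hT
    refine aux_gen m ?_
    rintro ⟨x, F, hF⟩
    have : ∀ S, ∃ h : (Fin m → T) →ₗ[R] N S, h (f 1) = x S ∧ (x S = 0 → h = 0) := by
      intro S
      by_cases hx : x S = 0
      · exact ⟨0, by simp [hx], fun _ => rfl⟩
      · obtain ⟨h, hh⟩ := hf (N S) (hN S) (LinearMap.toSpanSingleton R _ (x S))
        refine ⟨h, ?_, fun h => absurd h hx⟩
        have := LinearMap.congr_fun hh 1
        simpa using this
    choose h hh1 hh2 using this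
    refine ⟨(LinearMap.pi h).codRestrict N' (fun y => ⟨F, fun S hS => ?_⟩), f 1, ?_⟩
    · rw [LinearMap.pi_apply, hh2 S (hF S hS), LinearMap.zero_apply]
    · apply Subtype.ext
      funext S
      exact hh1 S
  let G : (T →₀ R) →ₗ[R] (∀ S, N S) := LinearMap.pi g
  have hG : ∀ k : K, (G.comp K.subtype) k ∈ N' := fun k =>
    ⟨{k}, fun S hS => hgS S k (Finset.mem_image_of_mem _ (Finset.singleton_subset_iff.mp hS))⟩
  obtain ⟨u, hu⟩ := aux_extend (A := K) (B := T →₀ R) (C := T) (N := N')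
    (aux_ext_gen hT hN') K.subtype π K.injective_subtype hπ
    K.range_subtype ((G.comp K.subtype).codRestrict N' hG)
  let v : (T →₀ R) →ₗ[R] (∀ S, N S) := G - N'.subtype.comp u
  have hv : LinearMap.ker π ≤ LinearMap.ker v := by
    intro k hk
    have h1 : u k = ⟨G k, hG ⟨k, hk⟩⟩ := LinearMap.congr_fun hu ⟨k, hk⟩
    rw [LinearMap.mem_ker]
    simp [v, h1]
  choose F hF using fun i => (u (Finsupp.single (a i) 1)).2
  let S := Finset.univ.biUnion F
  let e2 := π.quotKerEquivOfSurjective hπ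
  obtain ⟨i, hi⟩ := hno S
    ((LinearMap.proj S).comp (((LinearMap.ker π).liftQ v hv).comp e2.symm.toLinearMap))
  apply hi
  have hx : e2.symm (a i) = (LinearMap.ker π).mkQ (Finsupp.single (a i) 1) := by
    rw [LinearEquiv.symm_apply_eq]; exact (hπa i).symm
  simp only [LinearMap.comp_apply, LinearEquiv.coe_coe, hx, Submodule.mkQ_apply,
    Submodule.liftQ_apply, LinearMap.proj_apply]
  have h0 := hF i S (Finset.subset_biUnion_of_mem F (Finset.mem_univ i))
  simp only [v, LinearMap.sub_apply, Pi.sub_apply, LinearMap.comp_apply, Submodule.subtype_apply]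
  rw [h0, sub_zero]
  exact hgw S i

theorem aux_sol_map {R : Type u} [CommRing R] {n : ℕ} (ψ : PPFormula R n) {M N : Type u}
    [AddCommGroup M] [Module R M] [AddCommGroup N] [Module R N] (f : M →ₗ[R] N)
    {a : Fin n → M} (ha : a ∈ ψ.sol M) : (fun i => f (a i)) ∈ ψ.sol N := by
  obtain ⟨y, hy⟩ := ha
  refine ⟨fun l => f (y l), fun j => ?_⟩
  have := congrArg f (hy j)
  simpa [map_sum] using this

/-!
STATEMENT 17: If `T` is tilting and `𝒟 = Gen T`, then `T` is strictly `𝒟`-atomic and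
for some `n` there is a map `R → T ^ n` which is a `𝒟`-preenvelope of `R`.
-/
theorem tilting_strictlyDAtomic_and_preenvelope (R : Type u) [CommRing R]
    (T : Type u) [AddCommGroup T] [Module R T] (hT : IsTilting R T) :
    IsStrictlyDAtomic R (InGen R T) T ∧
      ∃ (n : ℕ) (f : R →ₗ[R] (Fin n → T)),
        IsDPreenvelope R (InGen R T) R (Fin n → T) f := by
  refine ⟨⟨⟨?_, fun n a => ?_⟩, ?_⟩, aux_preenv hT⟩
  · exact aux_gen 1 (fun x => ⟨LinearMap.proj 0, fun _ => x, rfl⟩)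
  · obtain ⟨φ, ha, h⟩ := aux_main hT n a
    refine ⟨φ, ha, fun ψ hψ N _ _ hN b hb => ?_⟩
    obtain ⟨f, hf⟩ := h N hN b hb
    have := aux_sol_map ψ f hψ
    rwa [funext hf] at this
  · intro n a φ hφ N _ _ hN b hb
    obtain ⟨φ', ha, h⟩ := aux_main hT n a
    exact h N hN b (hφ.2 φ' ha N hN hb)
end
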